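/- arXiv:math/0209189 — 3 statements merged into one kernel-verified Lean document; each statement's English description precedes it below -/
import Mathlib

section
/- For every element w of the free group on two generators there exists a polynomial P with integer coefficients in three variables such that for all A, B in SL(2,ℂ), Tr(ρ_{A,B}(w)) = P(Tr A, Tr B, Tr(A·B)), where ρ_{A,B} is the group homomorphism from the free group on two generators to SL(2,ℂ) sending the first generator to A and the second to B. -/
/-- The trace of an element of `SL(2,ℂ)` viewed as a matrix. -/
noncomputable def tr (M : Matrix.SpecialLinearGroup (Fin 2) ℂ) : ℂ :=
  Matrix.trace (M : Matrix (Fin 2) (Fin 2) ℂ)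

open Matrix in
/-- Cayley–Hamilton for a `2 × 2` matrix of determinant one. -/
theorem Matrix.SpecialLinearGroup.coe_mul_self_fin_two {R : Type*} [CommRing R]
    (A : Matrix.SpecialLinearGroup (Fin 2) R) :
    (A : Matrix (Fin 2) (Fin 2) R) * A = trace (A : Matrix (Fin 2) (Fin 2) R) • A.1 - 1 := by
  have hA := A.det_coe
  rw [det_fin_two] at hA
  ext i j
  fin_cases i <;> fin_cases j <;> simp [mul_apply, trace_fin_two] <;> grind

open Matrix in
theorem Matrix.SpecialLinearGroup.coe_inv_fin_two {R : Type*} [CommRing R]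
    (A : Matrix.SpecialLinearGroup (Fin 2) R) :
    (↑A⁻¹ : Matrix (Fin 2) (Fin 2) R) = trace (A : Matrix (Fin 2) (Fin 2) R) • 1 - A.1 := by
  rw [SpecialLinearGroup.coe_inv, adjugate_fin_two]
  ext i j
  fin_cases i <;> fin_cases j <;> simp [trace_fin_two]

open Matrix in
/-- The polarized Cayley–Hamilton identity, solved for `B * A`. -/
theorem Matrix.mul_eq_of_swap_fin_two {R : Type*} [CommRing R] (A B : Matrix (Fin 2) (Fin 2) R) :
    B * A = (trace (A * B) - trace A * trace B) • (1 : Matrix (Fin 2) (Fin 2) R)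
      + trace B • A + trace A • B - A * B := by
  ext i j
  fin_cases i <;> fin_cases j <;> simp [mul_apply, trace_fin_two] <;> ring

/-- The image of `w` under every representation into `SL(2,ℂ)` is a combination of
`1, A, B, A * B` with coefficients that are fixed integer polynomials in the traces. -/
def HasTraceCoordinates (w : FreeGroup (Fin 2)) : Prop :=
  ∃ p q r s : MvPolynomial (Fin 3) ℤ, ∀ A B : Matrix.SpecialLinearGroup (Fin 2) ℂ,
    (FreeGroup.lift ![A, B] w).1 =
      MvPolynomial.aeval ![tr A, tr B, tr (A * B)] p • (1 : Matrix (Fin 2) (Fin 2) ℂ)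
      + MvPolynomial.aeval ![tr A, tr B, tr (A * B)] q • A.1
      + MvPolynomial.aeval ![tr A, tr B, tr (A * B)] r • B.1
      + MvPolynomial.aeval ![tr A, tr B, tr (A * B)] s • (A.1 * B.1)

namespace HasTraceCoordinates

open MvPolynomial

theorem one : HasTraceCoordinates 1 := ⟨1, 0, 0, 0, fun A B => by simp⟩

theorem of_zero_mul {w : FreeGroup (Fin 2)} (hw : HasTraceCoordinates w) :
    HasTraceCoordinates (FreeGroup.of 0 * w) := by
  obtain ⟨p, q, r, s, h⟩ := hw
  refine ⟨-q, p + X 0 * q, -s, r + X 0 * s, fun A B => ?_⟩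
  have hA : A.1 * A.1 = tr A • A.1 - 1 := Matrix.SpecialLinearGroup.coe_mul_self_fin_two A
  have hAAB : A.1 * (A.1 * B.1) = tr A • (A.1 * B.1) - B.1 := by
    rw [← mul_assoc, hA, sub_mul, smul_mul_assoc, one_mul]
  simp only [map_mul, FreeGroup.lift_apply_of, Matrix.SpecialLinearGroup.coe_mul, h]
  simp only [Matrix.cons_val_zero, map_neg, map_add, map_mul, aeval_X, mul_add, mul_smul_comm,
    mul_one, hA, hAAB]
  module

theorem of_one_mul {w : FreeGroup (Fin 2)} (hw : HasTraceCoordinates w) :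
    HasTraceCoordinates (FreeGroup.of 1 * w) := by
  obtain ⟨p, q, r, s, h⟩ := hw
  refine ⟨(X 2 - X 0 * X 1) * q - r - X 0 * s, X 1 * q + s,
    p + X 0 * q + X 1 * r + X 2 * s, -q, fun A B => ?_⟩
  have hB : B.1 * B.1 = tr B • B.1 - 1 := Matrix.SpecialLinearGroup.coe_mul_self_fin_two B
  have hBA : B.1 * A.1 = (tr (A * B) - tr A * tr B) • (1 : Matrix (Fin 2) (Fin 2) ℂ)
      + tr B • A.1 + tr A • B.1 - A.1 * B.1 := Matrix.mul_eq_of_swap_fin_two A.1 B.1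
  have hBAB : B.1 * (A.1 * B.1) = A.1 - tr A • (1 : Matrix (Fin 2) (Fin 2) ℂ)
      + tr (A * B) • B.1 := by
    rw [← mul_assoc, hBA]
    simp only [sub_mul, add_mul, smul_mul_assoc, one_mul, mul_assoc, hB, mul_sub, mul_smul_comm,
      mul_one]
    module
  simp only [map_mul, FreeGroup.lift_apply_of, Matrix.SpecialLinearGroup.coe_mul, h]
  simp only [Matrix.cons_val_zero, Matrix.cons_val_one, Matrix.cons_val, map_neg, map_add, map_sub,
    map_mul, aeval_X, mul_add, mul_smul_comm, mul_one, hB, hBA, hBAB]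
  module

theorem of_mul (i : Fin 2) {w : FreeGroup (Fin 2)} (hw : HasTraceCoordinates w) :
    HasTraceCoordinates (FreeGroup.of i * w) := by
  fin_cases i
  exacts [hw.of_zero_mul, hw.of_one_mul]

theorem of_inv_mul (i : Fin 2) {w : FreeGroup (Fin 2)} (hw : HasTraceCoordinates w) :
    HasTraceCoordinates ((FreeGroup.of i)⁻¹ * w) := by
  obtain ⟨p', q', r', s', h'⟩ := hw.of_mul i
  obtain ⟨p, q, r, s, h⟩ := hw
  let t : MvPolynomial (Fin 3) ℤ := X (i.castSucc)
  refine ⟨t * p - p', t * q - q', t * r - r', t * s - s', fun A B => ?_⟩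
  have ht : aeval ![tr A, tr B, tr (A * B)] t = tr (![A, B] i) := by
    fin_cases i <;> simp [t]
  have hinv : (![A, B] i)⁻¹.1 = tr (![A, B] i) • 1 - (![A, B] i).1 :=
    Matrix.SpecialLinearGroup.coe_inv_fin_two _
  have h' := h' A B
  simp only [map_mul, FreeGroup.lift_apply_of, Matrix.SpecialLinearGroup.coe_mul] at h'
  simp only [map_mul, map_inv, FreeGroup.lift_apply_of, Matrix.SpecialLinearGroup.coe_mul, hinv,
    sub_mul, smul_mul_assoc, one_mul, h']
  simp only [h, map_sub, map_mul, ht]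
  module

end HasTraceCoordinates

theorem hasTraceCoordinates (w : FreeGroup (Fin 2)) : HasTraceCoordinates w := by
  suffices ∀ v, HasTraceCoordinates v → HasTraceCoordinates (w * v) by
    simpa using this 1 .one
  induction w using FreeGroup.induction_on with
  | C1 => simp
  | of i => exact fun v hv => hv.of_mul i
  | inv_of i _ => exact fun v hv => hv.of_inv_mul i
  | mul x y hx hy => exact fun v hv => mul_assoc x y v ▸ hx _ (hy v hv)

/-- For every word `w` in the free group on two generators there is an integer polynomial
`P` in three variables such that for all `A, B ∈ SL(2,ℂ)`,
`Tr(ρ_{A,B}(w)) = P(Tr A, Tr B, Tr AB)`, where `ρ_{A,B}` sends the generators to `A` and `B`. -/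
theorem trace_word_polynomial (w : FreeGroup (Fin 2)) :
    ∃ P : MvPolynomial (Fin 3) ℤ,
      ∀ A B : Matrix.SpecialLinearGroup (Fin 2) ℂ,
        tr ((FreeGroup.lift ![A, B]) w) =
          MvPolynomial.aeval ![tr A, tr B, tr (A * B)] P := by
  obtain ⟨p, q, r, s, h⟩ := hasTraceCoordinates w
  refine ⟨2 * p + .X 0 * q + .X 1 * r + .X 2 * s, fun A B => ?_⟩
  have hAB : Matrix.trace (A.1 * B.1) = tr (A * B) := rfl
  have hA : Matrix.trace A.1 = tr A := rfl
  have hB : Matrix.trace B.1 = tr B := rfl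
  rw [tr, h]
  simp [Matrix.trace_add, Matrix.trace_smul, hAB, hA, hB]
  ring
end

section
/- For every triple (x, y, z) ∈ ℂ³ there exist matrices A, B in SL(2,ℂ) with Tr A = x, Tr B = y and Tr(A·B) = z. -/
/-- Every complex number is the sum of two numbers whose product is `1`. -/
theorem exists_mul_eq_one_and_add_eq (z : ℂ) : ∃ t s : ℂ, t * s = 1 ∧ t + s = z := by
  obtain ⟨w, hw⟩ := IsAlgClosed.exists_eq_mul_self (z ^ 2 - 4)
  refine ⟨(z + w) / 2, (z - w) / 2, ?_, by ring⟩
  linear_combination hw / 4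

/-- Every triple `(x, y, z) ∈ ℂ³` is realized as `(Tr A, Tr B, Tr AB)` for some
`A, B ∈ SL(2,ℂ)`. -/
theorem traces_realized (x y z : ℂ) :
    ∃ A B : Matrix.SpecialLinearGroup (Fin 2) ℂ,
      tr A = x ∧ tr B = y ∧ tr (A * B) = z := by
  obtain ⟨t, s, hmul, hadd⟩ := exists_mul_eq_one_and_add_eq z
  refine ⟨⟨!![x, -1; 1, 0], by simp [Matrix.det_fin_two]⟩,
    ⟨!![0, t; -s, y], by simp [Matrix.det_fin_two, hmul]⟩, ?_, ?_, ?_⟩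
  · simp [tr, Matrix.trace_fin_two]
  · simp [tr, Matrix.trace_fin_two]
  · change Matrix.trace (!![x, -1; 1, 0] * !![0, t; -s, y]) = z
    simp [Matrix.trace_fin_two, ← hadd, add_comm]
end

section
/- Let U be an open preconnected subset of ℂ × ℂ and let (f_n) be a sequence of functions ℂ × ℂ → ℂ, each analytic on a neighborhood of each point of U, with Re(f_n(z)) ≥ 0 for all z ∈ U and all n. Suppose there exist real numbers a, b and r > 0 such that every point (x, y) with x, y real, |x − a| < r and |y − b| < r lies in U, and that f_n converges pointwise on this set of real points to a (finite-valued) function. Then there exists a function F, analytic on a neighborhood of each point of U, such that f_n converges to F locally uniformly on U. -/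
open Filter

section LocalBounds

variable {E : Type*} [NormedAddCommGroup E] [NormedSpace ℂ E]

/-- A Harnack type bound for holomorphic functions with values in the closed right half plane. -/
lemma norm_le_of_re_nonneg_of_mem_ball {g : E → ℂ} {c w : E} {R : ℝ}
    (hg : DifferentiableOn ℂ g (Metric.ball c R)) (hre : ∀ z ∈ Metric.ball c R, 0 ≤ (g z).re)
    (hw : w ∈ Metric.ball c (R / 2)) : ‖g w‖ ≤ 2 + 3 * ‖g c‖ := by
  rw [mem_ball_iff_norm] at hw
  have hmaps : Set.MapsTo (fun t : ℂ => c + t • (w - c)) (Metric.ball 0 2) (Metric.ball c R) := by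
    intro t ht
    rw [mem_ball_zero_iff] at ht
    rw [mem_ball_iff_norm, add_sub_cancel_left, norm_smul]
    nlinarith [norm_nonneg (w - c), norm_nonneg t]
  have hd : DifferentiableOn ℂ (fun t : ℂ => -g (c + t • (w - c))) (Metric.ball 0 2) :=
    (hg.comp (by fun_prop) hmaps).neg
  have h := Complex.borelCaratheodory (z := 1) one_pos hd
    (fun t ht => by
      have := hre _ (hmaps ht)
      simp only [Set.mem_ofPred_eq, Complex.neg_re]
      linarith) two_pos (by simp)
  simp only [one_smul, add_sub_cancel, norm_neg, zero_smul, add_zero, norm_one] at h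
  linarith

lemma exists_forall_norm_le_of_re_nonneg {ι : Type*} {U : Set E} (hU : IsOpen U)
    (hconn : IsPreconnected U) {f : ι → E → ℂ} (hf : ∀ i, DifferentiableOn ℂ (f i) U)
    (hre : ∀ i, ∀ z ∈ U, 0 ≤ (f i z).re) {p : E} (hp : p ∈ U)
    (hbdd : ∃ M, ∀ i, ‖f i p‖ ≤ M) {z : E} (hz : z ∈ U) : ∃ M, ∀ i, ‖f i z‖ ≤ M := by
  have key : ∀ {c w : E} {R : ℝ}, Metric.ball c R ⊆ U → w ∈ Metric.ball c (R / 2) →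
      (∃ M, ∀ i, ‖f i c‖ ≤ M) → ∃ M, ∀ i, ‖f i w‖ ≤ M := by
    rintro c w R hR hw ⟨M, hM⟩
    refine ⟨2 + 3 * M, fun i => ?_⟩
    have := norm_le_of_re_nonneg_of_mem_ball ((hf i).mono hR) (fun z hz => hre i z (hR hz)) hw
    linarith [hM i]
  let B : Set E := {z | z ∈ U ∧ ∃ M, ∀ i, ‖f i z‖ ≤ M}
  suffices h : U ⊆ B from (h hz).2
  refine hconn.subset_of_closure_inter_subset ?_ ⟨p, hp, hp, hbdd⟩ ?_
  · rw [Metric.isOpen_iff]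
    rintro c ⟨hc, hM⟩
    obtain ⟨R, hR, hRU⟩ := Metric.isOpen_iff.1 hU c hc
    exact ⟨R / 2, half_pos hR, fun w hw =>
      ⟨hRU (Metric.ball_subset_ball (by linarith) hw), key hRU hw hM⟩⟩
  · rintro w ⟨hwB, hwU⟩
    obtain ⟨R, hR, hRU⟩ := Metric.isOpen_iff.1 hU w hwU
    obtain ⟨c, ⟨-, hM⟩, hc⟩ := Metric.mem_closure_iff.1 hwB (R / 4) (by linarith)
    refine ⟨hwU, key (R := R / 2) (fun x hx => hRU ?_) ?_ hM⟩
    · rw [Metric.mem_ball] at hx ⊢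
      linarith [dist_triangle x c w, dist_comm w c]
    · rw [Metric.mem_ball]
      linarith

lemma equicontinuousAt_of_re_nonneg {ι : Type*} {U : Set E} (hU : IsOpen U)
    {f : ι → E → ℂ} (hf : ∀ i, DifferentiableOn ℂ (f i) U)
    (hre : ∀ i, ∀ z ∈ U, 0 ≤ (f i z).re) {c : E} (hc : c ∈ U)
    (hbdd : ∃ M, ∀ i, ‖f i c‖ ≤ M) :
    EquicontinuousAt f c := by
  obtain ⟨M, hM⟩ := hbdd
  obtain ⟨R, hR, hRU⟩ := Metric.isOpen_iff.1 hU c hc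
  have hsub : Metric.ball c (R / 2) ⊆ U :=
    (Metric.ball_subset_ball (by linarith)).trans hRU
  refine Metric.equicontinuousAt_of_continuity_modulus
    (fun z => (2 + 4 * M) / (R / 2) * dist z c) ?_ f ?_
  · have : ContinuousAt (fun z => (2 + 4 * M) / (R / 2) * dist z c) c := by fun_prop
    simpa [ContinuousAt] using this
  · filter_upwards [Metric.ball_mem_nhds c (half_pos hR)] with z hz i
    rw [dist_comm]
    refine Complex.dist_le_div_mul_dist_of_mapsTo_ball ((hf i).mono hsub) (fun w hw => ?_) hz
    rw [mem_closedBall_iff_norm]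
    have := norm_le_of_re_nonneg_of_mem_ball ((hf i).mono hRU) (fun z hz => hre i z (hRU hz)) hw
    linarith [norm_sub_le (f i w) (f i c), hM i]

end LocalBounds

lemma tendstoLocallyUniformlyOn_of_equicontinuousAt {ι X α : Type*} [TopologicalSpace X]
    [PseudoMetricSpace α] {U : Set X} {f : ι → X → α} {F : X → α} {l : Filter ι} [l.NeBot]
    (heq : ∀ x ∈ U, EquicontinuousAt f x) (hF : ∀ x ∈ U, Tendsto (f · x) l (nhds (F x))) :
    TendstoLocallyUniformlyOn f F l U := by
  rw [Metric.tendstoLocallyUniformlyOn_iff]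
  intro ε hε x hx
  have h := Metric.equicontinuousAt_iff_right.1 (heq x hx) (ε / 4) (by linarith)
  refine ⟨_, inter_mem (mem_nhdsWithin_of_mem_nhds h) self_mem_nhdsWithin, ?_⟩
  filter_upwards [Metric.tendsto_nhds.1 (hF x hx) (ε / 4) (by linarith)] with n hn y hy
  have h1 : dist (F x) (F y) ≤ ε / 4 :=
    le_of_tendsto ((hF x hx).dist (hF y hy.2)) (Eventually.of_forall fun i => (hy.1 i).le)
  have h2 := hy.1 n
  linarith [dist_triangle4 (F y) (F x) (f n x) (f n y), dist_comm (F y) (F x),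
    dist_comm (F x) (f n x)]

section Osgood

/-- The contour integral over a circle as a continuous linear functional on the continuous
functions on that circle. -/
noncomputable def circleIntegralCLM (c : ℂ) (R : ℝ) : C(Metric.sphere c |R|, ℂ) →L[ℂ] ℂ :=
  have hcont (g : C(Metric.sphere c |R|, ℂ)) : Continuous fun θ : ℝ =>
      deriv (circleMap c R) θ * g ⟨circleMap c R θ, circleMap_mem_sphere' c R θ⟩ := by
    simp only [deriv_circleMap]
    fun_prop
  LinearMap.mkContinuous
    { toFun := fun g => ∫ θ in (0 : ℝ)..2 * Real.pi,
        deriv (circleMap c R) θ * g ⟨circleMap c R θ, circleMap_mem_sphere' c R θ⟩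
      map_add' := fun g h => by
        rw [← intervalIntegral.integral_add ((hcont g).intervalIntegrable _ _)
          ((hcont h).intervalIntegrable _ _)]
        simp [mul_add]
      map_smul' := fun a g => by
        rw [RingHom.id_apply, smul_eq_mul, ← intervalIntegral.integral_const_mul]
        simp [mul_left_comm] }
    (|R| * |2 * Real.pi - 0|) fun g => by
      refine (intervalIntegral.norm_integral_le_of_norm_le_const (C := |R| * ‖g‖)
        fun θ _ => ?_).trans_eq (by ring)
      rw [norm_mul]
      gcongr
      · simp
      · exact g.norm_coe_le_norm _

lemma circleIntegralCLM_apply {c : ℂ} {R : ℝ} (g : C(Metric.sphere c |R|, ℂ)) {h : ℂ → ℂ}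
    (hgh : ∀ t, g t = h t) : circleIntegralCLM c R g = ∮ t in C(c, R), h t := by
  simp [circleIntegralCLM, circleIntegral, hgh]

/-- The Cauchy kernel, as a function of the pole, is analytic with values in the continuous
functions on the circle. -/
lemma exists_analyticAt_cauchyKernel (K : Set ℂ) [CompactSpace K] :
    ∃ k : ℂ → C(K, ℂ), ∀ w ∉ K, AnalyticAt ℂ k w ∧ ∀ t : K, k w t = ((t : ℂ) - w)⁻¹ := by
  let ι : C(K, ℂ) := ⟨Subtype.val, continuous_subtype_val⟩
  refine ⟨fun w => Ring.inverse (ι - algebraMap ℂ C(K, ℂ) w), fun w hw => ?_⟩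
  have hunit : IsUnit (ι - algebraMap ℂ C(K, ℂ) w) := by
    rw [ContinuousMap.isUnit_iff_forall_ne_zero]
    intro t ht
    apply hw
    have : (t : ℂ) - w = 0 := by simpa [ι] using ht
    rw [← sub_eq_zero.1 this]
    exact t.2
  constructor
  · obtain ⟨u, hu⟩ := hunit
    have h1 : AnalyticAt ℂ (fun w => ι - algebraMap ℂ C(K, ℂ) w) w := by
      have : AnalyticAt ℂ (fun w : ℂ => algebraMap ℂ C(K, ℂ) w) w :=
        (Algebra.linearMap ℂ C(K, ℂ)).toContinuousLinearMap.analyticAt w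
      exact analyticAt_const.sub this
    exact AnalyticAt.fun_comp (hu ▸ analyticAt_inverse u) h1
  · intro t
    refine eq_inv_of_mul_eq_one_left ?_
    have := congrArg (fun g : C(K, ℂ) => g t) (Ring.inverse_mul_cancel _ hunit)
    simpa [ι] using this

/-- **Osgood's lemma**: a continuous function of two complex variables which is holomorphic in each
variable separately is analytic. -/
lemma analyticAt_of_continuousOn_of_differentiableOn {F : ℂ × ℂ → ℂ} {U : Set (ℂ × ℂ)}
    (hU : IsOpen U) (hF : ContinuousOn F U)
    (h1 : ∀ w, DifferentiableOn ℂ (fun z => F (z, w)) {z | (z, w) ∈ U})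
    (h2 : ∀ z, DifferentiableOn ℂ (fun w => F (z, w)) {w | (z, w) ∈ U})
    {p : ℂ × ℂ} (hp : p ∈ U) : AnalyticAt ℂ F p := by
  obtain ⟨R, hR, hRU⟩ := Metric.nhds_basis_closedBall.mem_iff.1 (hU.mem_nhds hp)
  have hmem : ∀ {z w}, z ∈ Metric.closedBall p.1 R → w ∈ Metric.closedBall p.2 R →
      (z, w) ∈ U := fun hz hw => hRU (by
    rw [← closedBall_prod_same]
    exact ⟨hz, hw⟩)
  obtain ⟨F', hF'⟩ := ContinuousMap.exists_restrict_eq (Metric.isClosed_closedBall (x := p) (ε := R))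
    ⟨_, (hF.mono hRU).domRestrict⟩
  have hF' : ∀ {z w}, z ∈ Metric.closedBall p.1 R → w ∈ Metric.closedBall p.2 R →
      F' (z, w) = F (z, w) := fun {z w} hz hw =>
    congrArg (fun g => g ⟨(z, w), by rw [← closedBall_prod_same]; exact ⟨hz, hw⟩⟩) hF'
  have habs : |R| = R := abs_of_pos hR
  let K := Metric.sphere p.2 |R|
  have hK : ∀ t : K, (t : ℂ) ∈ Metric.closedBall p.2 R := fun t =>
    habs ▸ Metric.sphere_subset_closedBall t.2
  let G : C(ℂ, C(K, ℂ)) := ContinuousMap.curry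
    ⟨fun x : ℂ × K => F' (x.1, x.2), by fun_prop⟩
  let H : ℂ → C(K, ℂ) := fun z =>
    (2 * ↑Real.pi * Complex.I)⁻¹ • ∮ s in C(p.1, R), (s - z)⁻¹ • G s
  have hH : AnalyticAt ℂ H p.1 := by
    lift R to NNReal using hR.le
    exact (hasFPowerSeriesOn_cauchy_integral
      (G.continuous.continuousOn.circleIntegrable R.2) hR).analyticAt
  have hHt : ∀ z ∈ Metric.ball p.1 R, ∀ t : K, H z t = F (z, t) := by
    intro z hz t
    have hint : IntervalIntegrable (fun θ : ℝ => deriv (circleMap p.1 R) θ •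
        ((circleMap p.1 R θ - z)⁻¹ • G (circleMap p.1 R θ))) MeasureTheory.volume
        0 (2 * Real.pi) := by
      apply Continuous.intervalIntegrable
      have : Continuous fun θ : ℝ => (circleMap p.1 R θ - z)⁻¹ :=
        continuous_circleMap_inv hz
      simp only [deriv_circleMap]
      fun_prop
    have h3 : H z t = (2 * ↑Real.pi * Complex.I)⁻¹ • ∮ s in C(p.1, R), (s - z)⁻¹ • G s t := by
      have := (ContinuousMap.evalCLM ℂ t).intervalIntegral_comp_comm hint
      simp only [H, circleIntegral, ContinuousMap.smul_apply]
      congr 1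
      simpa using this.symm
    have h4 : ∮ s in C(p.1, R), (s - z)⁻¹ • G s t = ∮ s in C(p.1, R), (s - z)⁻¹ • F (s, t) := by
      refine circleIntegral.integral_congr hR.le fun s hs => ?_
      congr 1
      exact hF' (Metric.sphere_subset_closedBall hs) (hK t)
    rw [h3, h4]
    have hd : DifferentiableOn ℂ (fun z => F (z, t)) (Metric.closedBall p.1 R) :=
      (h1 t).mono fun s hs => hmem hs (hK t)
    exact (hd.diffContOnCl_ball subset_rfl).two_pi_i_inv_smul_circleIntegral_sub_inv_smul hz
  obtain ⟨k, hk⟩ := exists_analyticAt_cauchyKernel K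
  have hnot : ∀ w ∈ Metric.ball p.2 R, w ∉ K := fun w hw hwK => by
    simp only [K, habs, Metric.mem_sphere] at hwK
    exact (Metric.mem_ball.1 hw).ne hwK
  have hfinal : AnalyticAt ℂ (fun x : ℂ × ℂ => (2 * ↑Real.pi * Complex.I)⁻¹ *
      circleIntegralCLM p.2 R (k x.2 * H x.1)) p := by
    have e1 : AnalyticAt ℂ (fun x : ℂ × ℂ => k x.2) p :=
      (hk p.2 (hnot _ (Metric.mem_ball_self hR))).1.fun_comp analyticAt_snd
    have e2 : AnalyticAt ℂ (fun x : ℂ × ℂ => H x.1) p := hH.fun_comp analyticAt_fst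
    exact analyticAt_const.mul
      (((circleIntegralCLM p.2 R).analyticAt _).fun_comp (e1.mul e2))
  refine hfinal.congr ?_
  filter_upwards [Metric.ball_mem_nhds p hR] with x hx
  obtain ⟨z, w⟩ := x
  rw [← ball_prod_same] at hx
  obtain ⟨hz, hw⟩ := hx
  have hd : DifferentiableOn ℂ (fun w => F (z, w)) (Metric.closedBall p.2 R) :=
    (h2 z).mono fun s hs => hmem (Metric.ball_subset_closedBall hz) hs
  rw [circleIntegralCLM_apply (h := fun t => (t - w)⁻¹ • F (z, t))]
  · exact (hd.diffContOnCl_ball subset_rfl).two_pi_i_inv_smul_circleIntegral_sub_inv_smul hw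
  · intro t
    simp [(hk w (hnot w hw)).2 t, hHt z hz t]

end Osgood

lemma TendstoLocallyUniformlyOn.analyticAt_prod {ι : Type*} {l : Filter ι} [l.NeBot]
    {f : ι → ℂ × ℂ → ℂ} {F : ℂ × ℂ → ℂ} {U : Set (ℂ × ℂ)}
    (h : TendstoLocallyUniformlyOn f F l U) (hU : IsOpen U)
    (hf : ∀ i, DifferentiableOn ℂ (f i) U) {z : ℂ × ℂ} (hz : z ∈ U) : AnalyticAt ℂ F z := by
  refine analyticAt_of_continuousOn_of_differentiableOn hU
    (h.continuousOn (Frequently.of_forall fun i => (hf i).continuousOn)) (fun w => ?_)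
    (fun z => ?_) hz
  · refine (h.comp (fun z => (z, w)) (t := {z | (z, w) ∈ U}) (fun _ hz => hz)
      (by fun_prop)).differentiableOn (Eventually.of_forall fun i => ?_)
      (hU.preimage (by fun_prop))
    exact (hf i).comp (by fun_prop) fun _ hz => hz
  · refine (h.comp (fun w => (z, w)) (t := {w | (z, w) ∈ U}) (fun _ hw => hw)
      (by fun_prop)).differentiableOn (Eventually.of_forall fun i => ?_)
      (hU.preimage (by fun_prop))
    exact (hf i).comp (by fun_prop) fun _ hw => hw

section IdentityTheorem

lemma eqOn_ball_of_eq_ofReal {g h : ℂ → ℂ} {a r : ℝ} (hr : 0 < r)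
    (hg : AnalyticOnNhd ℂ g (Metric.ball (a : ℂ) r))
    (hh : AnalyticOnNhd ℂ h (Metric.ball (a : ℂ) r))
    (heq : ∀ x : ℝ, |x - a| < r → g x = h x) : Set.EqOn g h (Metric.ball (a : ℂ) r) := by
  refine hg.eqOn_of_preconnected_of_frequently_eq hh (convex_ball _ _).isPreconnected
    (Metric.mem_ball_self hr) ?_
  have ht : Tendsto (fun x : ℝ => (x : ℂ)) (nhdsWithin a {a}ᶜ) (nhdsWithin (a : ℂ) {(a : ℂ)}ᶜ) :=
    Complex.continuous_ofReal.continuousAt.continuousWithinAt.tendsto_nhdsWithin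
      fun x hx => by simpa using hx
  refine ht.frequently (Eventually.frequently ?_)
  filter_upwards [mem_nhdsWithin_of_mem_nhds (Metric.ball_mem_nhds a hr)] with x hx
  exact heq x hx

/-- Analytic functions on a preconnected open subset of `ℂ²` which agree on the real points near
some real point agree everywhere. -/
lemma AnalyticOnNhd.eqOn_of_eq_ofReal_prod {g h : ℂ × ℂ → ℂ} {U : Set (ℂ × ℂ)} (hU : IsOpen U)
    (hconn : IsPreconnected U) (hg : AnalyticOnNhd ℂ g U) (hh : AnalyticOnNhd ℂ h U)
    {a b r : ℝ} (hr : 0 < r) (hab : ((a : ℂ), (b : ℂ)) ∈ U)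
    (heq : ∀ x y : ℝ, |x - a| < r → |y - b| < r → g (x, y) = h (x, y)) : Set.EqOn g h U := by
  obtain ⟨R, hR, hRU⟩ := Metric.isOpen_iff.1 hU _ hab
  obtain ⟨ρ, hρ, hρr, hρR⟩ : ∃ ρ > 0, ρ ≤ r ∧ ρ ≤ R :=
    ⟨min r R, lt_min hr hR, min_le_left _ _, min_le_right _ _⟩
  have hmem : ∀ {z w : ℂ}, z ∈ Metric.ball (a : ℂ) ρ → w ∈ Metric.ball (b : ℂ) ρ →
      (z, w) ∈ U := fun hz hw => hRU (by
    rw [← ball_prod_same]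
    exact ⟨Metric.ball_subset_ball hρR hz, Metric.ball_subset_ball hρR hw⟩)
  have hreal : ∀ {x c : ℝ}, |x - c| < ρ → (x : ℂ) ∈ Metric.ball (c : ℂ) ρ := fun {x c} hx => by
    rwa [mem_ball_iff_norm, ← Complex.ofReal_sub, Complex.norm_real, Real.norm_eq_abs]
  have hslice1 : ∀ {k : ℂ × ℂ → ℂ}, AnalyticOnNhd ℂ k U → ∀ w ∈ Metric.ball (b : ℂ) ρ,
      AnalyticOnNhd ℂ (fun z => k (z, w)) (Metric.ball (a : ℂ) ρ) := fun hk w hw z hz =>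
    (hk _ (hmem hz hw)).fun_comp (f := fun z => (z, w)) (analyticAt_id.prod analyticAt_const)
  have hslice2 : ∀ {k : ℂ × ℂ → ℂ}, AnalyticOnNhd ℂ k U → ∀ z ∈ Metric.ball (a : ℂ) ρ,
      AnalyticOnNhd ℂ (fun w => k (z, w)) (Metric.ball (b : ℂ) ρ) := fun hk z hz w hw =>
    (hk _ (hmem hz hw)).fun_comp (f := fun w => (z, w)) (analyticAt_const.prod analyticAt_id)
  refine hg.eqOn_of_preconnected_of_eventuallyEq hh hconn hab ?_
  filter_upwards [Metric.ball_mem_nhds ((a : ℂ), (b : ℂ)) hρ] with x hx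
  obtain ⟨z, w⟩ := x
  rw [← ball_prod_same] at hx
  obtain ⟨hz, hw⟩ := hx
  refine eqOn_ball_of_eq_ofReal hρ (hslice2 hg z hz) (hslice2 hh z hz) (fun y hy => ?_) hw
  exact eqOn_ball_of_eq_ofReal hρ (hslice1 hg y (hreal hy)) (hslice1 hh y (hreal hy))
    (fun x hx => heq x y (hx.trans_le hρr) (hy.trans_le hρr)) hz

end IdentityTheorem

/-- A sequence of holomorphic functions on an open connected `U ⊆ ℂ²`, all taking values in the
closed right half plane, which converges pointwise on a real 2-dimensional polydisc contained in
`U`, converges locally uniformly on `U` to a holomorphic limit. -/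
theorem normal_family_convergence
    (U : Set (ℂ × ℂ)) (hU : IsOpen U) (hconn : IsPreconnected U)
    (f : ℕ → ℂ × ℂ → ℂ) (hf : ∀ n, ∀ z ∈ U, AnalyticAt ℂ (f n) z)
    (hre : ∀ n, ∀ z ∈ U, 0 ≤ (f n z).re)
    (a b : ℝ) (r : ℝ) (hr : 0 < r)
    (hmem : ∀ x y : ℝ, |x - a| < r → |y - b| < r → ((x : ℂ), (y : ℂ)) ∈ U)
    (hconv : ∀ x y : ℝ, |x - a| < r → |y - b| < r →
      ∃ L : ℂ, Tendsto (fun n => f n ((x : ℂ), (y : ℂ))) atTop (nhds L)) :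
    ∃ F : ℂ × ℂ → ℂ, (∀ z ∈ U, AnalyticAt ℂ F z) ∧
      TendstoLocallyUniformlyOn f F atTop U := by
  have hd : ∀ n, DifferentiableOn ℂ (f n) U := fun n => AnalyticOnNhd.differentiableOn (hf n)
  have hab : ((a : ℂ), (b : ℂ)) ∈ U := hmem a b (by simpa) (by simpa)
  have hbdd : ∀ z ∈ U, ∃ M, ∀ n, ‖f n z‖ ≤ M := fun z hz => by
    refine exists_forall_norm_le_of_re_nonneg hU hconn hd hre hab ?_ hz
    obtain ⟨L, hL⟩ := hconv a b (by simpa) (by simpa)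
    obtain ⟨M, hM⟩ := (Metric.isBounded_range_of_tendsto _ hL).exists_norm_le
    exact ⟨M, fun n => hM _ ⟨n, rfl⟩⟩
  have heq : ∀ z ∈ U, EquicontinuousAt f z := fun z hz =>
    equicontinuousAt_of_re_nonneg hU hd hre hz (hbdd z hz)
  -- the pointwise limit along an arbitrary ultrafilter finer than `atTop`
  have hlim : ∀ u : Ultrafilter ℕ, ∃ F : ℂ × ℂ → ℂ, ∀ z ∈ U, Tendsto (f · z) u (nhds (F z)) := by
    intro u
    have (z : ℂ × ℂ) : ∃ L, z ∈ U → Tendsto (f · z) u (nhds L) := by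
      by_cases hz : z ∈ U
      · obtain ⟨M, hM⟩ := hbdd z hz
        obtain ⟨L, -, hL⟩ := (isCompact_closedBall (0 : ℂ) M).ultrafilter_le_nhds (u.map (f · z))
          (le_principal_iff.2 (Ultrafilter.mem_map.2
            (univ_mem' fun n => mem_closedBall_zero_iff.2 (hM n))))
        exact ⟨L, fun _ => hL⟩
      · exact ⟨0, fun h => absurd h hz⟩
    choose F hF using this
    exact ⟨F, hF⟩
  have han : ∀ (u : Ultrafilter ℕ) (F : ℂ × ℂ → ℂ), (∀ z ∈ U, Tendsto (f · z) u (nhds (F z))) →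
      AnalyticOnNhd ℂ F U := fun u F hF z hz =>
    (tendstoLocallyUniformlyOn_of_equicontinuousAt heq hF).analyticAt_prod hU hd hz
  obtain ⟨F, hF⟩ := hlim (hyperfilter ℕ)
  refine ⟨F, han _ F hF, tendstoLocallyUniformlyOn_of_equicontinuousAt heq fun z hz => ?_⟩
  rw [tendsto_iff_ultrafilter]
  intro u hu
  obtain ⟨G, hG⟩ := hlim u
  suffices h : Set.EqOn F G U from h hz ▸ hG z hz
  refine (han _ F hF).eqOn_of_eq_ofReal_prod hU hconn (han u G hG) hr hab fun x y hx hy => ?_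
  obtain ⟨L, hL⟩ := hconv x y hx hy
  rw [tendsto_nhds_unique (hF _ (hmem x y hx hy)) (hL.mono_left Nat.hyperfilter_le_atTop),
    tendsto_nhds_unique (hG _ (hmem x y hx hy)) (hL.mono_left hu)]
end
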